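/- Let m ≥ 2 and n ≥ 1 be integers and let 𝒜, ℬ be symmetric m-th order n-dimensional real tensors with 𝒜 strictly copositive. Then sup{φ₀(u,v) : (u,v) ∈ F} > 0; consequently, any global maximizer (ū, v̄) of φ₀ over F satisfies φ₀(ū, v̄) > 0 and ū ≠ 0. -/

import Mathlib

open Finset

/-- `𝒜x^{m-1}` for an `(k+1)`-th order `n`-dimensional tensor `A`. -/
noncomputable def tApply {n k : ℕ} (A : (Fin (k + 1) → Fin n) → ℝ) (x : Fin n → ℝ) :
    Fin n → ℝ :=
  fun i => ∑ g : Fin k → Fin n, A (Fin.cons i g) * ∏ j, x (g j)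

/-- `𝒜x^m` for an `m`-th order `n`-dimensional tensor `A`. -/
noncomputable def tEval {n m : ℕ} (A : (Fin m → Fin n) → ℝ) (x : Fin n → ℝ) : ℝ :=
  ∑ f : Fin m → Fin n, A f * ∏ j, x (f j)

/-- the tensor `λ^m 𝒜 + λ ℬ + 𝒞` where `m = k + 2`. -/
noncomputable def triple {n k : ℕ} (A B C : (Fin (k + 2) → Fin n) → ℝ) (lam : ℝ) :
    (Fin (k + 2) → Fin n) → ℝ :=
  fun f => lam ^ (k + 2) * A f + lam * B f + C f

/-- `(λ, x)` is an `m`-degree Pareto-eigenpair of the triplet `(A, B, C)`, `m = k + 2`. -/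
noncomputable def IsParetoPair {n k : ℕ} (A B C : (Fin (k + 2) → Fin n) → ℝ)
    (lam : ℝ) (x : Fin n → ℝ) : Prop :=
  x ≠ 0 ∧ (∀ i, 0 ≤ x i) ∧ (∀ i, 0 ≤ tApply (triple A B C lam) x i) ∧
    (∑ i, x i * tApply (triple A B C lam) x i) = 0

/-- the unit tensor `ℐ`: entries `1` if all indices coincide and `0` otherwise. -/
noncomputable def unitT {n k : ℕ} : (Fin (k + 2) → Fin n) → ℝ :=
  fun f => if ∀ t, f t = f 0 then 1 else 0

/-- a tensor is symmetric if its entries are invariant under permutations of the indices. -/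
def IsSymm' {n m : ℕ} (A : (Fin m → Fin n) → ℝ) : Prop :=
  ∀ (σ : Equiv.Perm (Fin m)) (f : Fin m → Fin n), A (f ∘ σ) = A f

/-- the objective `φ₀(u,v) = m(m-1)^{1/m−1} v^⊤ u^{[m-1]} − ℬu^m`, `m = k + 2`. -/
noncomputable def phi0 {n k : ℕ} (B : (Fin (k + 2) → Fin n) → ℝ) (u v : Fin n → ℝ) : ℝ :=
  (k + 2 : ℝ) * ((k + 1 : ℝ) ^ ((1 : ℝ) / (k + 2) - 1)) * (∑ i, v i * u i ^ (k + 1)) -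
    tEval B u

/-- membership in the feasible set `F = {(u,v) ≥ 0 : 𝒜u^m + ∑ v_i^m = 1}`. -/
noncomputable def Feasible {n k : ℕ} (A : (Fin (k + 2) → Fin n) → ℝ) (u v : Fin n → ℝ) :
    Prop :=
  (∀ i, 0 ≤ u i) ∧ (∀ i, 0 ≤ v i) ∧ tEval A u + ∑ i, v i ^ (k + 2) = 1

theorem tEval_smul {n m : ℕ} (A : (Fin m → Fin n) → ℝ) (r : ℝ) (x : Fin n → ℝ) :
    tEval A (r • x) = r ^ m * tEval A x := by
  unfold tEval
  rw [Finset.mul_sum]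
  refine Finset.sum_congr rfl fun f _ => ?_
  simp only [Pi.smul_apply, smul_eq_mul, Finset.prod_mul_distrib, Finset.prod_const,
    Finset.card_univ, Fintype.card_fin]
  ring

theorem tEval_zero {n k : ℕ} (A : (Fin (k + 1) → Fin n) → ℝ) :
    tEval A (0 : Fin n → ℝ) = 0 := by
  simp [tEval]

theorem continuous_tEval {n m : ℕ} (A : (Fin m → Fin n) → ℝ) :
    Continuous fun x : Fin n → ℝ => tEval A x := by
  unfold tEval
  fun_prop

theorem phi0_smul {n k : ℕ} (B : (Fin (k + 2) → Fin n) → ℝ) (r : ℝ) (u v : Fin n → ℝ) :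
    phi0 B (r • u) (r • v) = r ^ (k + 2) * phi0 B u v := by
  have h : ∑ i, (r • v) i * (r • u) i ^ (k + 1) =
      r ^ (k + 2) * ∑ i, v i * u i ^ (k + 1) := by
    rw [Finset.mul_sum]
    refine Finset.sum_congr rfl fun i _ => ?_
    simp only [Pi.smul_apply, smul_eq_mul]
    ring
  unfold phi0
  rw [h, tEval_smul]
  ring

theorem phi0_zero_left {n k : ℕ} (B : (Fin (k + 2) → Fin n) → ℝ) (v : Fin n → ℝ) :
    phi0 B 0 v = 0 := by
  simp [phi0, tEval_zero]

theorem continuous_phi0 {n k : ℕ} (B : (Fin (k + 2) → Fin n) → ℝ) :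
    Continuous fun w : (Fin n → ℝ) × (Fin n → ℝ) => phi0 B w.1 w.2 := by
  have := (continuous_tEval B).comp (continuous_fst (X := Fin n → ℝ) (Y := Fin n → ℝ))
  simp only [Function.comp_def] at this
  unfold phi0
  fun_prop

/-- The left-hand side of the equation defining `F`. -/
noncomputable def feasGauge {n k : ℕ} (A : (Fin (k + 2) → Fin n) → ℝ) (u v : Fin n → ℝ) : ℝ :=
  tEval A u + ∑ i, v i ^ (k + 2)

theorem feasGauge_smul {n k : ℕ} (A : (Fin (k + 2) → Fin n) → ℝ) (r : ℝ) (u v : Fin n → ℝ) :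
    feasGauge A (r • u) (r • v) = r ^ (k + 2) * feasGauge A u v := by
  simp only [feasGauge, tEval_smul, Pi.smul_apply, smul_eq_mul, mul_pow, mul_add, Finset.mul_sum]

theorem continuous_feasGauge {n k : ℕ} (A : (Fin (k + 2) → Fin n) → ℝ) :
    Continuous fun w : (Fin n → ℝ) × (Fin n → ℝ) => feasGauge A w.1 w.2 := by
  have := (continuous_tEval A).comp (continuous_fst (X := Fin n → ℝ) (Y := Fin n → ℝ))
  simp only [Function.comp_def] at this
  unfold feasGauge
  fun_prop

theorem feasGauge_pos {n k : ℕ} {A : (Fin (k + 2) → Fin n) → ℝ}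
    (hA : ∀ x : Fin n → ℝ, (∀ i, 0 ≤ x i) → x ≠ 0 → 0 < tEval A x)
    {u v : Fin n → ℝ} (hu : ∀ i, 0 ≤ u i) (hv : ∀ i, 0 ≤ v i) (h : (u, v) ≠ 0) :
    0 < feasGauge A u v := by
  have hsum : 0 ≤ ∑ i, v i ^ (k + 2) := Finset.sum_nonneg fun i _ => pow_nonneg (hv i) _
  by_cases hu0 : u = 0
  · subst hu0
    have hv0 : v ≠ 0 := fun hv0 => h (by rw [hv0]; rfl)
    obtain ⟨i, hi⟩ := Function.ne_iff.mp hv0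
    have : 0 < ∑ i, v i ^ (k + 2) :=
      Finset.sum_pos' (fun i _ => pow_nonneg (hv i) _)
        ⟨i, Finset.mem_univ i, pow_pos (lt_of_le_of_ne (hv i) (Ne.symm hi)) _⟩
    simpa [feasGauge, tEval_zero] using this
  · exact add_pos_of_pos_of_nonneg (hA u hu hu0) hsum

theorem exists_phi0_le_mul_feasGauge {n k : ℕ} {A : (Fin (k + 2) → Fin n) → ℝ}
    (B : (Fin (k + 2) → Fin n) → ℝ)
    (hA : ∀ x : Fin n → ℝ, (∀ i, 0 ≤ x i) → x ≠ 0 → 0 < tEval A x) :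
    ∃ C : ℝ, ∀ u v : Fin n → ℝ, (∀ i, 0 ≤ u i) → (∀ i, 0 ≤ v i) → (u, v) ≠ 0 →
      phi0 B u v ≤ C * feasGauge A u v := by
  have hS : IsCompact (Metric.sphere (0 : (Fin n → ℝ) × (Fin n → ℝ)) 1 ∩ Set.Ici 0) :=
    (isCompact_sphere 0 1).inter_right isClosed_Ici
  have hpos : ∀ w ∈ Metric.sphere (0 : (Fin n → ℝ) × (Fin n → ℝ)) 1 ∩ Set.Ici 0,
      0 < feasGauge A w.1 w.2 := by
    intro w hw
    exact feasGauge_pos hA hw.2.1 hw.2.2 (ne_zero_of_mem_unit_sphere ⟨w, hw.1⟩)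
  obtain ⟨C, hC⟩ := hS.bddAbove_image
    ((continuous_phi0 B).continuousOn.div (continuous_feasGauge A).continuousOn
      fun w hw => (hpos w hw).ne')
  refine ⟨C, fun u v hu hv hw => ?_⟩
  have hnorm : 0 < ‖(u, v)‖ := norm_pos_iff.mpr hw
  obtain ⟨r, hr⟩ : ∃ r : ℝ, r = ‖(u, v)‖⁻¹ := ⟨_, rfl⟩
  have hrpos : 0 < r := hr ▸ inv_pos.mpr hnorm
  have hmem : (r • u, r • v) ∈
      Metric.sphere (0 : (Fin n → ℝ) × (Fin n → ℝ)) 1 ∩ Set.Ici 0 := by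
    refine ⟨?_, fun i => mul_nonneg hrpos.le (hu i), fun i => mul_nonneg hrpos.le (hv i)⟩
    rw [mem_sphere_zero_iff_norm, ← Prod.smul_mk, norm_smul, Real.norm_of_nonneg hrpos.le, hr]
    exact inv_mul_cancel₀ hnorm.ne'
  have hle : phi0 B (r • u) (r • v) / feasGauge A (r • u) (r • v) ≤ C :=
    hC (Set.mem_image_of_mem _ hmem)
  rwa [phi0_smul, feasGauge_smul, mul_div_mul_left _ _ (pow_pos hrpos _).ne',
    div_le_iff₀ (feasGauge_pos hA hu hv hw)] at hle

theorem bddAbove_phi0_feasible {n k : ℕ} {A : (Fin (k + 2) → Fin n) → ℝ}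
    (B : (Fin (k + 2) → Fin n) → ℝ)
    (hA : ∀ x : Fin n → ℝ, (∀ i, 0 ≤ x i) → x ≠ 0 → 0 < tEval A x) :
    BddAbove {r : ℝ | ∃ u v : Fin n → ℝ, Feasible A u v ∧ phi0 B u v = r} := by
  obtain ⟨C, hC⟩ := exists_phi0_le_mul_feasGauge B hA
  refine ⟨C, ?_⟩
  rintro _ ⟨u, v, ⟨hu, hv, hfeas⟩, rfl⟩
  have h1 : feasGauge A u v = 1 := hfeas
  have hw : (u, v) ≠ 0 := by
    intro h
    obtain ⟨rfl, rfl⟩ := Prod.mk.inj h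
    simp [feasGauge, tEval_zero] at h1
  simpa [h1] using hC u v hu hv hw

theorem exists_phi0_pos {n k : ℕ} (hn : 1 ≤ n) (B : (Fin (k + 2) → Fin n) → ℝ) :
    ∃ u v : Fin n → ℝ, (∀ i, 0 ≤ u i) ∧ (∀ i, 0 ≤ v i) ∧ 0 < phi0 B u v := by
  set c : ℝ := (k + 2 : ℝ) * ((k + 1 : ℝ) ^ ((1 : ℝ) / (k + 2) - 1)) with hc
  have hcpos : 0 < c := by positivity
  have hnpos : (0 : ℝ) < n := by exact_mod_cast hn
  set b := tEval B (fun _ => (1 : ℝ)) with hb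
  refine ⟨fun _ => 1, fun _ => (|b| + 1) / (c * n), fun _ => zero_le_one,
    fun _ => by positivity, ?_⟩
  have h : phi0 B (fun _ => (1 : ℝ)) (fun _ => (|b| + 1) / (c * n)) = |b| + 1 - b := by
    unfold phi0
    rw [← hc, ← hb]
    simp only [one_pow, mul_one, Finset.sum_const, Finset.card_univ, Fintype.card_fin,
      nsmul_eq_mul]
    field_simp
  rw [h]
  linarith [le_abs_self b]

theorem exists_feasible_phi0_pos {n k : ℕ} (hn : 1 ≤ n) {A : (Fin (k + 2) → Fin n) → ℝ}
    (B : (Fin (k + 2) → Fin n) → ℝ)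
    (hA : ∀ x : Fin n → ℝ, (∀ i, 0 ≤ x i) → x ≠ 0 → 0 < tEval A x) :
    ∃ u v : Fin n → ℝ, Feasible A u v ∧ 0 < phi0 B u v := by
  obtain ⟨u, v, hu, hv, hphi⟩ := exists_phi0_pos hn B
  have hw : (u, v) ≠ 0 := by
    intro h
    obtain ⟨rfl, rfl⟩ := Prod.mk.inj h
    simp [phi0_zero_left] at hphi
  have hg := feasGauge_pos hA hu hv hw
  set r := ((feasGauge A u v)⁻¹) ^ (((k + 2 : ℕ) : ℝ)⁻¹) with hr
  have hrpos : 0 < r := Real.rpow_pos_of_pos (inv_pos.mpr hg) _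
  have hrpow : r ^ (k + 2) = (feasGauge A u v)⁻¹ :=
    Real.rpow_inv_natCast_pow (inv_pos.mpr hg).le (by omega)
  refine ⟨r • u, r • v, ⟨fun i => mul_nonneg hrpos.le (hu i),
    fun i => mul_nonneg hrpos.le (hv i), ?_⟩, ?_⟩
  · change feasGauge A (r • u) (r • v) = 1
    rw [feasGauge_smul, hrpow, inv_mul_cancel₀ hg.ne']
  · rw [phi0_smul]
    positivity


/-- If `𝒜, ℬ` are symmetric and `𝒜` strictly copositive, then
`sup {φ₀(u,v) : (u,v) ∈ F} > 0`, and every global maximizer `(ū, v̄)` of `φ₀` over `F`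
satisfies `φ₀(ū, v̄) > 0` and `ū ≠ 0`, `m = k + 2`. -/
theorem sup_phi_pos (k n : ℕ) (hn : 1 ≤ n)
    (A B : (Fin (k + 2) → Fin n) → ℝ) (hA : IsSymm' A) (hB : IsSymm' B)
    (hscop : ∀ x : Fin n → ℝ, (∀ i, 0 ≤ x i) → x ≠ 0 → 0 < tEval A x) :
    0 < sSup {r : ℝ | ∃ u v : Fin n → ℝ, Feasible A u v ∧ phi0 B u v = r} ∧
    ∀ u v : Fin n → ℝ, Feasible A u v →
      (∀ u' v' : Fin n → ℝ, Feasible A u' v' → phi0 B u' v' ≤ phi0 B u v) →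
      0 < phi0 B u v ∧ u ≠ 0 := by
  obtain ⟨u₀, v₀, hfeas, hpos⟩ := exists_feasible_phi0_pos hn B hscop
  refine ⟨hpos.trans_le (le_csSup (bddAbove_phi0_feasible B hscop) ⟨u₀, v₀, hfeas, rfl⟩), ?_⟩
  intro u v _ hmax
  have h := hpos.trans_le (hmax u₀ v₀ hfeas)
  refine ⟨h, ?_⟩
  rintro rfl
  exact h.ne' (phi0_zero_left B v)
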